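/- Fix κ > 0 and X₃ ∈ ℝ with X₃² > 8κ. Let A ∈ C²(ℝ, M²) be the solution of the initial value problem Ä + κA = Λ(A,Ȧ)·cof A with data (A₀,B₀) ∈ D satisfying X₁(A₀,B₀) = κ + ¼X₃², X₂(A₀,B₀) = 0, X₃(A₀,B₀) = X₃, and A₀ ∉ SO(2,ℝ). Then for every μ with 0 < μ < ½(X₃² − 8κ)^{1/2} there exist T > 0, a constant C > 0, and phases θ₊, θ₋ ∈ ℝ such that: |A(t) − U(½X₃t + θ₊)| ≤ C e^{−μt} and |Ȧ(t) − ½X₃·Z·U(½X₃t + θ₊)| ≤ C e^{−μt} and ⟨A(t), Ȧ(t)⟩ < 0 for all t > T; and |A(t) − U(½X₃t + θ₋)| ≤ C e^{μt} and |Ȧ(t) − ½X₃·Z·U(½X₃t + θ₋)| ≤ C e^{μt} and ⟨A(t), Ȧ(t)⟩ > 0 for all t < −T. -/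

import Mathlib

open Matrix

noncomputable section

/-- `M²`: the space of 2×2 real matrices. -/
abbrev M2 : Type := Matrix (Fin 2) (Fin 2) ℝ

/-- Frobenius inner product `⟨A,B⟩ = tr(AᵀB)`. -/
def mip (A B : M2) : ℝ := (Aᵀ * B).trace

/-- Frobenius norm `|A| = ⟨A,A⟩^{1/2}`. -/
def fnorm (A : M2) : ℝ := Real.sqrt (mip A A)

/-- The matrix Z = [[0,−1],[1,0]]. -/
def Zm : M2 := !![0, -1; 1, 0]

/-- The matrix K = [[1,0],[0,−1]]. -/
def Km : M2 := !![1, 0; 0, -1]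

/-- The matrix M = [[0,1],[1,0]]. -/
def Mm : M2 := !![0, 1; 1, 0]

/-- Cofactor: cof [[a,b],[c,d]] = [[d,−c],[−b,a]]. -/
def cofm (A : M2) : M2 := !![A 1 1, -(A 1 0); -(A 0 1), A 0 0]

/-- Membership in SO(2,ℝ). -/
def isSO (U : M2) : Prop := U.det = 1 ∧ U⁻¹ = Uᵀ

/-- The rotation U(θ) = cos θ·I + sin θ·Z. -/
def Um (θ : ℝ) : M2 := Real.cos θ • (1 : M2) + Real.sin θ • Zm

/-- Invariant X₁(A,B) = ½|B|² + (κ/2)|A|². -/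
def X1 (κ : ℝ) (A B : M2) : ℝ := (1/2) * mip B B + (κ/2) * mip A A

/-- Invariant X₂(A,B) = ½⟨ZA − AZ, B⟩. -/
def X2 (A B : M2) : ℝ := (1/2) * mip (Zm * A - A * Zm) B

/-- Invariant X₃(A,B) = ½⟨ZA + AZ, B⟩. -/
def X3 (A B : M2) : ℝ := (1/2) * mip (Zm * A + A * Zm) B

/-- Lagrange multiplier Λ(A,B) = 2(κ − det B)/|A|². -/
def Lam (κ : ℝ) (A B : M2) : ℝ := 2 * (κ - B.det) / (mip A A)

attribute [local instance] Matrix.normedAddCommGroup Matrix.normedSpace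

/-- A function whose derivative is exponentially small converges exponentially fast. -/
theorem exists_limit_of_abs_deriv_le_exp {f f' : ℝ → ℝ} {T C μ : ℝ} (hμ : 0 < μ)
    (hf : ∀ t, HasDerivAt f (f' t) t) (hb : ∀ t ≥ T, |f' t| ≤ C * Real.exp (-μ * t)) :
    ∃ l, ∀ t ≥ T, |f t - l| ≤ C / μ * Real.exp (-μ * t) := by
  have hE : ∀ t, HasDerivAt (fun t => C / μ * Real.exp (-μ * t)) (-(C * Real.exp (-μ * t))) t := by
    intro t
    have := (((hasDerivAt_id' t).const_mul (-μ)).exp).const_mul (C / μ)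
    refine this.congr_deriv ?_
    field_simp
  have hC : 0 ≤ C := by
    have := (abs_nonneg _).trans (hb T le_rfl)
    exact nonneg_of_mul_nonneg_left this (Real.exp_pos _)
  have anti : AntitoneOn (fun t => f t + C / μ * Real.exp (-μ * t)) (Set.Ici T) := by
    apply antitoneOn_of_hasDerivWithinAt_nonpos (convex_Ici T)
      (fun t _ => ((hf t).add (hE t)).continuousAt.continuousWithinAt)
      (fun t _ => ((hf t).add (hE t)).hasDerivWithinAt)
    intro t ht
    rw [interior_Ici] at ht
    linarith [abs_le.1 (hb t (le_of_lt ht))]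
  have mono : MonotoneOn (fun t => f t - C / μ * Real.exp (-μ * t)) (Set.Ici T) := by
    apply monotoneOn_of_hasDerivWithinAt_nonneg (convex_Ici T)
      (fun t _ => ((hf t).sub (hE t)).continuousAt.continuousWithinAt)
      (fun t _ => ((hf t).sub (hE t)).hasDerivWithinAt)
    intro t ht
    rw [interior_Ici] at ht
    linarith [abs_le.1 (hb t (le_of_lt ht))]
  have hpos : ∀ t, 0 ≤ C / μ * Real.exp (-μ * t) := fun t => by positivity
  have key : ∀ s ≥ T, ∀ t ≥ T,
      f s - C / μ * Real.exp (-μ * s) ≤ f t + C / μ * Real.exp (-μ * t) := by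
    intro s hs t ht
    rcases le_total s t with h | h
    · have := mono hs ht h
      simp only at this
      linarith [hpos t]
    · have := anti ht hs h
      simp only at this
      linarith [hpos s]
  set S := Set.image (fun s => f s - C / μ * Real.exp (-μ * s)) (Set.Ici T)
  have hbd : ∀ t ≥ T, f t + C / μ * Real.exp (-μ * t) ∈ upperBounds S := by
    rintro t ht _ ⟨s, hs, rfl⟩
    exact key s hs t ht
  refine ⟨sSup S, fun t ht => abs_le.2 ⟨?_, ?_⟩⟩
  · have : sSup S ≤ f t + C / μ * Real.exp (-μ * t) :=
      csSup_le ⟨_, T, Set.self_mem_Ici, rfl⟩ (hbd t ht)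
    linarith
  · have : f t - C / μ * Real.exp (-μ * t) ≤ sSup S :=
      le_csSup ⟨_, hbd t ht⟩ ⟨t, ht, rfl⟩
    linarith

/-- Grönwall bound on a half-line for `w' ≤ c w`, in the form of monotonicity. -/
theorem antitoneOn_mul_exp_of_deriv_le {w w' : ℝ → ℝ} {s : Set ℝ} (hs : Convex ℝ s) {c : ℝ}
    (hw : ∀ t, HasDerivAt w (w' t) t) (hb : ∀ t ∈ s, w' t ≤ -c * w t) :
    AntitoneOn (fun t => w t * Real.exp (c * t)) s := by
  have hE : ∀ t, HasDerivAt (fun t => w t * Real.exp (c * t))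
      ((w' t + c * w t) * Real.exp (c * t)) t := by
    intro t
    have := (hw t).mul (((hasDerivAt_id' t).const_mul c).exp)
    refine this.congr_deriv ?_
    ring
  apply antitoneOn_of_hasDerivWithinAt_nonpos hs
    (fun t _ => (hE t).continuousAt.continuousWithinAt)
    (fun t _ => (hE t).hasDerivWithinAt)
  intro t ht
  exact mul_nonpos_of_nonpos_of_nonneg (by linarith [hb t (interior_subset ht)]) (Real.exp_pos _).le

/-- If `|w'| ≤ c w` and `w` is positive at one time, it is positive at all times. -/
theorem pos_of_abs_deriv_le {w w' : ℝ → ℝ} {c : ℝ} (hw : ∀ t, HasDerivAt w (w' t) t)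
    (hb : ∀ t, |w' t| ≤ c * w t) (h0 : 0 < w 0) (t : ℝ) : 0 < w t := by
  rcases le_total t 0 with h | h
  · have := antitoneOn_mul_exp_of_deriv_le convex_univ (c := -c) hw
      (fun t _ => by linarith [abs_le.1 (hb t)]) (Set.mem_univ t) (Set.mem_univ 0) h
    simp only [mul_zero, Real.exp_zero, mul_one] at this
    exact pos_of_mul_pos_left (h0.trans_le this) (Real.exp_pos _).le
  · have := antitoneOn_mul_exp_of_deriv_le convex_univ (c := c) (w := fun t => - w t)
      (fun t => (hw t).neg)
      (fun t _ => by linarith [abs_le.1 (hb t)]) (Set.mem_univ 0) (Set.mem_univ t) h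
    simp only [mul_zero, Real.exp_zero, mul_one] at this
    exact pos_of_mul_pos_left (h0.trans_le (by linarith)) (Real.exp_pos (c * t)).le

/-- The planar system `w' = 2 G w`, `G' = -2 w (κ + G²) / (1 + 2 w)` restricted to the level set
`G² (1 + 2 w) = N - 2 κ w`: every orbit with `w > 0` is attracted to `(0, -√N)`. -/
theorem reduced_system_decay {w G : ℝ → ℝ} {κ N μ : ℝ} (hκ : 0 < κ) (hμ : 0 < μ)
    (hμN : μ ^ 2 < N) (hpos : ∀ t, 0 < w t)
    (hw : ∀ t, HasDerivAt w (2 * G t * w t) t)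
    (hG : ∀ t, HasDerivAt G (-(2 * w t * (κ + G t ^ 2) / (1 + 2 * w t))) t)
    (hlevel : ∀ t, G t ^ 2 * (1 + 2 * w t) = N - 2 * κ * w t) :
    ∃ T > 0, ∃ C > 0, ∀ t ≥ T, G t < 0 ∧ w t ≤ C * Real.exp (-μ * t) ^ 2 := by
  have hGanti : Antitone G := by
    apply antitone_of_hasDerivAt_nonpos hG
    intro t
    have := hpos t
    have : 0 ≤ 2 * w t * (κ + G t ^ 2) / (1 + 2 * w t) := by positivity
    simpa using this
  have decay : ∀ δ T, (∀ t ≥ T, G t ≤ -δ) →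
      ∀ t ≥ T, w t ≤ w T * Real.exp (2 * δ * T) * Real.exp (-δ * t) ^ 2 := by
    intro δ T h t ht
    have := antitoneOn_mul_exp_of_deriv_le (convex_Ici T) (c := 2 * δ) hw
      (fun t ht => by nlinarith [h t ht, hpos t]) Set.self_mem_Ici ht ht
    simp only at this
    have h1 : Real.exp (2 * δ * t) * Real.exp (-δ * t) ^ 2 = 1 := by
      rw [← Real.exp_nat_mul, ← Real.exp_add, Real.exp_eq_one_iff]
      push_cast; ring
    calc w t = w t * Real.exp (2 * δ * t) * Real.exp (-δ * t) ^ 2 := by rw [mul_assoc, h1, mul_one]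
      _ ≤ _ := by gcongr
  obtain ⟨T₁, hT₁⟩ : ∃ T₁, G T₁ < 0 := by
    by_contra! hcon
    have wmono : Monotone w := by
      apply monotone_of_hasDerivAt_nonneg hw
      intro t
      have := hpos t
      have := hcon t
      show 0 ≤ 2 * G t * w t
      positivity
    have h0 := hpos 0
    set c := 2 * w 0 * κ / (1 + 2 * w 0) with hc
    have hcpos : 0 < c := by positivity
    have anti : AntitoneOn (fun t => G t + c * t) (Set.Ici 0) := by
      have hd : ∀ t, HasDerivAt (fun t => G t + c * t)
          (-(2 * w t * (κ + G t ^ 2) / (1 + 2 * w t)) + c * 1) t :=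
        fun t => (hG t).add ((hasDerivAt_id t).const_mul c)
      apply antitoneOn_of_hasDerivWithinAt_nonpos (convex_Ici 0)
        (fun t _ => (hd t).continuousAt.continuousWithinAt)
        (fun t _ => (hd t).hasDerivWithinAt)
      intro t ht
      rw [interior_Ici] at ht
      have h1 : w 0 ≤ w t := wmono (le_of_lt ht)
      have h2 := hpos t
      have : c ≤ 2 * w t * (κ + G t ^ 2) / (1 + 2 * w t) := by
        rw [hc, div_le_div_iff₀ (by positivity) (by positivity)]
        have : 0 ≤ 2 * w t * G t ^ 2 * (1 + 2 * w 0) := by positivity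
        nlinarith
      linarith
    have hG0 := hcon 0
    have ht : (0:ℝ) ≤ (G 0 + 1) / c := by positivity
    have := anti (Set.self_mem_Ici) ht ht
    simp only [mul_zero, add_zero] at this
    rw [mul_div_cancel₀ _ hcpos.ne'] at this
    linarith [hcon ((G 0 + 1) / c)]
  have hdec := decay (-G T₁) T₁ (fun t ht => by simpa using hGanti ht)
  have hlim : Filter.Tendsto (fun t => w T₁ * Real.exp (2 * -G T₁ * T₁) *
      Real.exp (- -G T₁ * t) ^ 2) Filter.atTop (nhds 0) := by
    have h1 : Filter.Tendsto (fun t => Real.exp (- -G T₁ * t)) Filter.atTop (nhds 0) := by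
      apply Real.tendsto_exp_atBot.comp
      rw [neg_neg]
      exact Filter.tendsto_id.const_mul_atTop_of_neg hT₁
    simpa using (h1.pow 2).const_mul (w T₁ * Real.exp (2 * -G T₁ * T₁))
  have hε : 0 < (N - μ ^ 2) / (2 * (κ + μ ^ 2)) := div_pos (by linarith) (by positivity)
  obtain ⟨T₂, hT₂⟩ := Filter.eventually_atTop.1 (hlim.eventually_lt_const hε)
  set T := max 1 (max T₁ T₂) with hT
  have hGμ : ∀ t ≥ T, G t ≤ -μ := by
    intro t ht
    have h1 : T₁ ≤ t := le_trans (by simp [hT]) ht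
    have h2 : T₂ ≤ t := le_trans (by simp [hT]) ht
    have hwt := (hdec t h1).trans_lt (hT₂ t h2)
    rw [lt_div_iff₀ (by positivity)] at hwt
    have hneg : G t < 0 := (hGanti h1).trans_lt hT₁
    have hl := hlevel t
    have hp := hpos t
    by_contra! hlt
    have : G t ^ 2 < μ ^ 2 := by nlinarith
    nlinarith
  refine ⟨T, lt_of_lt_of_le one_pos (le_max_left _ _), w T * Real.exp (2 * μ * T),
    mul_pos (hpos T) (Real.exp_pos _), fun t ht => ⟨by linarith [hGμ t ht], decay μ T hGμ t ht⟩⟩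

/-- The equation of motion in the coordinates `A = p I + q Z + r K + s M`,
`B = P I + Q Z + R K + S M` of position and velocity, with Lagrange multiplier `L`. -/
structure IsCoordFlow (κ : ℝ) (p q r s P Q R S L : ℝ → ℝ) : Prop where
  hp : ∀ t, HasDerivAt p (P t) t
  hq : ∀ t, HasDerivAt q (Q t) t
  hr : ∀ t, HasDerivAt r (R t) t
  hs : ∀ t, HasDerivAt s (S t) t
  hP : ∀ t, HasDerivAt P ((L t - κ) * p t) t
  hQ : ∀ t, HasDerivAt Q ((L t - κ) * q t) t
  hR : ∀ t, HasDerivAt R (-(L t + κ) * r t) t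
  hS : ∀ t, HasDerivAt S (-(L t + κ) * s t) t
  hL : ∀ t, p t ^ 2 + q t ^ 2 + r t ^ 2 + s t ^ 2 ≠ 0 →
    L t * (p t ^ 2 + q t ^ 2 + r t ^ 2 + s t ^ 2) =
      κ - (P t ^ 2 + Q t ^ 2 - R t ^ 2 - S t ^ 2)

/-- The constraints and the values of the invariants `X₁`, `X₂`, `X₃` on the homoclinic level,
in coordinates. -/
structure IsHomoclinicLevel (κ X p q r s P Q R S : ℝ) : Prop where
  det_eq : p ^ 2 + q ^ 2 = 1 + (r ^ 2 + s ^ 2)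
  tangent : p * P + q * Q = r * R + s * S
  angular : p * Q - q * P = X / 2
  vorticity : r * S - s * R = 0
  energy : P ^ 2 + Q ^ 2 + R ^ 2 + S ^ 2 + κ * (p ^ 2 + q ^ 2 + r ^ 2 + s ^ 2) = κ + X ^ 2 / 4

theorem eq_of_hasDerivAt_zero {f : ℝ → ℝ} (hf : ∀ t, HasDerivAt f 0 t) (t : ℝ) : f t = f 0 :=
  is_const_of_deriv_eq_zero (fun t => (hf t).differentiableAt) (fun t => (hf t).deriv) t 0

theorem IsCoordFlow.isHomoclinicLevel {κ X : ℝ} (hκ : 0 < κ) {p q r s P Q R S L : ℝ → ℝ}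
    (h : IsCoordFlow κ p q r s P Q R S L)
    (h0 : IsHomoclinicLevel κ X (p 0) (q 0) (r 0) (s 0) (P 0) (Q 0) (R 0) (S 0)) (t : ℝ) :
    IsHomoclinicLevel κ X (p t) (q t) (r t) (s t) (P t) (Q t) (R t) (S t) := by
  have hD : ∀ t, HasDerivAt (fun t => p t ^ 2 + q t ^ 2 - (r t ^ 2 + s t ^ 2) - 1)
      (2 * (p t * P t + q t * Q t - (r t * R t + s t * S t))) t := fun t =>
    (((((h.hp t).pow 2).add ((h.hq t).pow 2)).sub
      (((h.hr t).pow 2).add ((h.hs t).pow 2))).sub_const 1).congr_deriv (by push_cast; ring)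
  have hE : ∀ t, HasDerivAt (fun t => p t * P t + q t * Q t - (r t * R t + s t * S t))
      (P t ^ 2 + Q t ^ 2 - R t ^ 2 - S t ^ 2 + L t * (p t ^ 2 + q t ^ 2 + r t ^ 2 + s t ^ 2)
        - κ * (p t ^ 2 + q t ^ 2 - (r t ^ 2 + s t ^ 2))) t := fun t =>
    ((((h.hp t).mul (h.hP t)).add ((h.hq t).mul (h.hQ t))).sub
      (((h.hr t).mul (h.hR t)).add ((h.hs t).mul (h.hS t)))).congr_deriv (by ring)
  -- With `D = det A - 1` of derivative `2 E`, the quantity `κ D² / 2 + E²` is constant: at a zero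
  -- of `A`, where the multiplier is not controlled, its derivative vanishes because `E = 0` there.
  have hF : ∀ t, HasDerivAt (fun t =>
      κ / 2 * (p t ^ 2 + q t ^ 2 - (r t ^ 2 + s t ^ 2) - 1) ^ 2 +
        (p t * P t + q t * Q t - (r t * R t + s t * S t)) ^ 2) 0 t := fun t => by
    refine ((((hD t).pow 2).const_mul (κ / 2)).add ((hE t).pow 2)).congr_deriv ?_
    by_cases hz : p t ^ 2 + q t ^ 2 + r t ^ 2 + s t ^ 2 = 0
    · obtain ⟨hp0, hq0, hr0, hs0⟩ : p t = 0 ∧ q t = 0 ∧ r t = 0 ∧ s t = 0 := by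
        refine ⟨?_, ?_, ?_, ?_⟩ <;> refine pow_eq_zero_iff two_ne_zero |>.1 ?_ <;>
          linarith [sq_nonneg (p t), sq_nonneg (q t), sq_nonneg (r t), sq_nonneg (s t)]
      simp [hp0, hq0, hr0, hs0]
    · rw [h.hL t hz]
      push_cast
      ring
  have hzero : ∀ t, κ / 2 * (p t ^ 2 + q t ^ 2 - (r t ^ 2 + s t ^ 2) - 1) ^ 2 +
      (p t * P t + q t * Q t - (r t * R t + s t * S t)) ^ 2 = 0 := fun t => by
    have hF0 := eq_of_hasDerivAt_zero hF t
    rw [h0.det_eq, h0.tangent] at hF0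
    rw [hF0]
    ring
  have hsplit := fun t => (add_eq_zero_iff_of_nonneg (by positivity) (sq_nonneg _)).1 (hzero t)
  have hdet : p t ^ 2 + q t ^ 2 - (r t ^ 2 + s t ^ 2) - 1 = 0 :=
    pow_eq_zero_iff two_ne_zero |>.1 ((mul_eq_zero_iff_left (by positivity)).1 (hsplit t).1)
  have htan : ∀ t, p t * P t + q t * Q t - (r t * R t + s t * S t) = 0 := fun t =>
    pow_eq_zero_iff two_ne_zero |>.1 (hsplit t).2
  have hang : ∀ t, HasDerivAt (fun t => p t * Q t - q t * P t) 0 t := fun t =>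
    (((h.hp t).mul (h.hQ t)).sub ((h.hq t).mul (h.hP t))).congr_deriv (by ring)
  have hvor : ∀ t, HasDerivAt (fun t => r t * S t - s t * R t) 0 t := fun t =>
    (((h.hr t).mul (h.hS t)).sub ((h.hs t).mul (h.hR t))).congr_deriv (by ring)
  have hen : ∀ t, HasDerivAt (fun t => P t ^ 2 + Q t ^ 2 + R t ^ 2 + S t ^ 2 +
      κ * (p t ^ 2 + q t ^ 2 + r t ^ 2 + s t ^ 2)) 0 t := fun t =>
    ((((((h.hP t).pow 2).add ((h.hQ t).pow 2)).add ((h.hR t).pow 2)).add ((h.hS t).pow 2)).add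
      ((((((h.hp t).pow 2).add ((h.hq t).pow 2)).add ((h.hr t).pow 2)).add
        ((h.hs t).pow 2)).const_mul κ)).congr_deriv (by
          push_cast
          linear_combination (2 * L t) * htan t)
  exact ⟨by linarith, by linarith [htan t], (eq_of_hasDerivAt_zero hang t).trans h0.angular,
    (eq_of_hasDerivAt_zero hvor t).trans h0.vorticity,
    (eq_of_hasDerivAt_zero hen t).trans h0.energy⟩

section

variable {κ X p q r s P Q R S : ℝ}

theorem IsHomoclinicLevel.sq_radial (h : IsHomoclinicLevel κ X p q r s P Q R S) :
    (R ^ 2 + S ^ 2) * (r ^ 2 + s ^ 2) = (r * R + s * S) ^ 2 := by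
  linear_combination (r * S - s * R) * h.vorticity

theorem IsHomoclinicLevel.radial (h : IsHomoclinicLevel κ X p q r s P Q R S) :
    (r * R + s * S) ^ 2 * (1 + 2 * (r ^ 2 + s ^ 2)) =
      (r ^ 2 + s ^ 2) ^ 2 * (X ^ 2 / 4 - 2 * κ - 2 * κ * (r ^ 2 + s ^ 2)) := by
  obtain ⟨h1, h2, h3, h4, h5⟩ := h
  have h6 : (P ^ 2 + Q ^ 2) * (1 + (r ^ 2 + s ^ 2)) = (r * R + s * S) ^ 2 + X ^ 2 / 4 := by
    rw [← h1, ← h2]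
    linear_combination (p * Q - q * P + X / 2) * h3
  have h7 : (R ^ 2 + S ^ 2) * (r ^ 2 + s ^ 2) = (r * R + s * S) ^ 2 := by
    linear_combination (r * S - s * R) * h4
  have h8 : P ^ 2 + Q ^ 2 = X ^ 2 / 4 - 2 * κ * (r ^ 2 + s ^ 2) - (R ^ 2 + S ^ 2) := by
    linear_combination h5 - κ * h1
  rw [h8] at h6
  linear_combination (-(r ^ 2 + s ^ 2)) * h6 - (1 + (r ^ 2 + s ^ 2)) * h7

theorem IsHomoclinicLevel.sq_rotation_defect (h : IsHomoclinicLevel κ X p q r s P Q R S) :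
    (P + X / 2 * q) ^ 2 + (Q - X / 2 * p) ^ 2 + (R ^ 2 + S ^ 2) =
      (X ^ 2 / 4 - 2 * κ) * (r ^ 2 + s ^ 2) := by
  obtain ⟨h1, h2, h3, h4, h5⟩ := h
  linear_combination h5 - X * h3 + (X ^ 2 / 4 - κ) * h1

end

/-- On the homoclinic level, the distance to the rotations decays exponentially forward in time. -/
theorem IsCoordFlow.forward_decay {κ X μ : ℝ} (hκ : 0 < κ) (hμ : 0 < μ)
    (hμX : μ ^ 2 < X ^ 2 / 4 - 2 * κ) {p q r s P Q R S L : ℝ → ℝ}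
    (h : IsCoordFlow κ p q r s P Q R S L)
    (h0 : IsHomoclinicLevel κ X (p 0) (q 0) (r 0) (s 0) (P 0) (Q 0) (R 0) (S 0))
    (hw0 : 0 < r 0 ^ 2 + s 0 ^ 2) :
    ∃ T > 0, ∃ C > 0, ∀ t ≥ T, r t * R t + s t * S t < 0 ∧
      r t ^ 2 + s t ^ 2 ≤ C * Real.exp (-μ * t) ^ 2 := by
  have hlev := h.isHomoclinicLevel hκ h0
  set N := X ^ 2 / 4 - 2 * κ
  have hNpos : 0 < N := lt_trans (by positivity) hμX
  set w : ℝ → ℝ := fun t => r t ^ 2 + s t ^ 2 with hw_def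
  have hw : ∀ t, HasDerivAt w (2 * (r t * R t + s t * S t)) t := fun t =>
    (((h.hr t).pow 2).add ((h.hs t).pow 2)).congr_deriv (by push_cast; ring)
  have hwnn : ∀ t, 0 ≤ w t := fun t => by positivity
  have hpos : ∀ t, 0 < w t := by
    refine pos_of_abs_deriv_le (c := 2 * Real.sqrt N) hw (fun t => ?_) hw0
    have h1 := (hlev t).radial
    rw [abs_mul, abs_two, mul_assoc]
    refine mul_le_mul_of_nonneg_left (abs_le_of_sq_le_sq ?_ (by positivity)) zero_le_two
    rw [mul_pow, Real.sq_sqrt hNpos.le]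
    have h2 := hwnn t
    change (r t * R t + s t * S t) ^ 2 * (1 + 2 * w t) = w t ^ 2 * (N - 2 * κ * w t) at h1
    have h3 : 0 ≤ w t ^ 2 * (2 * κ * w t) := by positivity
    have h4 : 0 ≤ (r t * R t + s t * S t) ^ 2 * (2 * w t) := by positivity
    linarith
  set G : ℝ → ℝ := fun t => (r t * R t + s t * S t) / w t
  have hGw : ∀ t, r t * R t + s t * S t = G t * w t := fun t =>
    (div_mul_cancel₀ _ (hpos t).ne').symm
  have hlevel : ∀ t, G t ^ 2 * (1 + 2 * w t) = N - 2 * κ * w t := fun t => by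
    have h1 := (hlev t).radial
    rw [hGw] at h1
    have := (hpos t).ne'
    apply mul_left_cancel₀ (pow_ne_zero 2 this)
    linear_combination h1
  have hRS : ∀ t, R t ^ 2 + S t ^ 2 = w t * G t ^ 2 := fun t => by
    have h1 := (hlev t).sq_radial
    rw [hGw] at h1
    apply mul_right_cancel₀ (hpos t).ne'
    linear_combination h1
  have hG : ∀ t, HasDerivAt G (-(2 * w t * (κ + G t ^ 2) / (1 + 2 * w t))) t := fun t => by
    have hp := hpos t
    refine ((((h.hr t).mul (h.hR t)).add ((h.hs t).mul (h.hS t))).div (hw t)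
      hp.ne').congr_deriv ?_
    have hl := hlev t
    have hL := h.hL t (by have := hl.det_eq; simp only [hw_def] at hp; nlinarith)
    have hsum : p t ^ 2 + q t ^ 2 + r t ^ 2 + s t ^ 2 = 1 + 2 * w t := by
      linear_combination hl.det_eq
    have hPQ : P t ^ 2 + Q t ^ 2 = N + 2 * κ - 2 * κ * w t - w t * G t ^ 2 := by
      linear_combination hl.energy - κ * hl.det_eq - hRS t
    have hL' : L t * (1 + 2 * w t) = κ - (N + 2 * κ - 2 * κ * w t - 2 * (w t * G t ^ 2)) := by
      rw [← hsum, hL]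
      linear_combination -hPQ + hRS t
    have hnum : R t * R t + r t * (-(L t + κ) * r t) + (S t * S t + s t * (-(L t + κ) * s t)) =
        w t * G t ^ 2 - (L t + κ) * w t := by
      linear_combination hRS t
    simp only [Pi.add_apply, Pi.mul_apply]
    rw [hnum, hGw, ← neg_div, div_eq_div_iff (by positivity) (by positivity)]
    linear_combination (-w t ^ 2) * hL' - w t ^ 2 * hlevel t
  obtain ⟨T, hT, C, hC, hdec⟩ := reduced_system_decay hκ hμ hμX hpos
    (fun t => (hw t).congr_deriv (by rw [hGw]; ring)) hG hlevel
  exact ⟨T, hT, C, hC, fun t ht => ⟨by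
    rw [hGw]
    exact mul_neg_of_neg_of_pos (hdec t ht).1 (hpos t), (hdec t ht).2⟩⟩

/-- Exponential convergence to a rigid rotation in coordinates, forward in time. -/
theorem IsCoordFlow.forward_asymptotics {κ X μ : ℝ} (hκ : 0 < κ) (hμ : 0 < μ)
    (hμX : μ ^ 2 < X ^ 2 / 4 - 2 * κ) {p q r s P Q R S L : ℝ → ℝ}
    (h : IsCoordFlow κ p q r s P Q R S L)
    (h0 : IsHomoclinicLevel κ X (p 0) (q 0) (r 0) (s 0) (P 0) (Q 0) (R 0) (S 0))
    (hw0 : 0 < r 0 ^ 2 + s 0 ^ 2) :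
    ∃ T > 0, ∃ C > 0, ∃ θ : ℝ, ∀ t > T,
      (|p t - Real.cos (X * t / 2 + θ)| ≤ C * Real.exp (-μ * t) ∧
        |q t - Real.sin (X * t / 2 + θ)| ≤ C * Real.exp (-μ * t) ∧
        |r t| ≤ C * Real.exp (-μ * t) ∧ |s t| ≤ C * Real.exp (-μ * t)) ∧
      (|P t + X / 2 * Real.sin (X * t / 2 + θ)| ≤ C * Real.exp (-μ * t) ∧
        |Q t - X / 2 * Real.cos (X * t / 2 + θ)| ≤ C * Real.exp (-μ * t) ∧
        |R t| ≤ C * Real.exp (-μ * t) ∧ |S t| ≤ C * Real.exp (-μ * t)) ∧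
      p t * P t + q t * Q t + r t * R t + s t * S t < 0 := by
  have hlev := h.isHomoclinicLevel hκ h0
  obtain ⟨T, hT, C, hC, hdec⟩ := h.forward_decay hκ hμ hμX h0 hw0
  set N := X ^ 2 / 4 - 2 * κ
  have hNpos : 0 < N := lt_trans (by positivity) hμX
  set w : ℝ → ℝ := fun t => r t ^ 2 + s t ^ 2 with hw_def
  have hwnn : ∀ t, 0 ≤ w t := fun t => by positivity
  have hrs : ∀ t ≥ T, ∀ y K : ℝ, 0 ≤ K → y ^ 2 ≤ K * w t →
      |y| ≤ Real.sqrt (K * C) * Real.exp (-μ * t) := by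
    intro t ht y K hK hy
    refine abs_le_of_sq_le_sq (hy.trans ?_) (by positivity)
    rw [mul_pow, Real.sq_sqrt (by positivity), mul_assoc]
    exact mul_le_mul_of_nonneg_left (hdec t ht).2 hK
  set D := Real.sqrt (N * C)
  have hDpos : 0 < D := Real.sqrt_pos.2 (by positivity)
  have hdef : ∀ t, (P t + X / 2 * q t) ^ 2 + (Q t - X / 2 * p t) ^ 2 + (R t ^ 2 + S t ^ 2) =
      N * w t := fun t => (hlev t).sq_rotation_defect
  -- the coordinates `(a, b)` of `(p, q)` in the frame rotating with angular velocity `X / 2`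
  have harg : ∀ t, HasDerivAt (fun t => X * t / 2) (X / 2) t := fun t =>
    (((hasDerivAt_id' t).const_mul X).div_const 2).congr_deriv (by ring)
  have hcos := fun t => (harg t).cos
  have hsin := fun t => (harg t).sin
  have hcs : ∀ t, Real.cos (X * t / 2) ^ 2 + Real.sin (X * t / 2) ^ 2 = 1 := fun t =>
    Real.cos_sq_add_sin_sq _
  obtain ⟨l, hl⟩ := exists_limit_of_abs_deriv_le_exp hμ (T := T) (C := D)
    (f := fun t => p t * Real.cos (X * t / 2) + q t * Real.sin (X * t / 2))
    (f' := fun t => (P t + X / 2 * q t) * Real.cos (X * t / 2) +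
      (Q t - X / 2 * p t) * Real.sin (X * t / 2))
    (fun t => (((h.hp t).mul (hcos t)).add ((h.hq t).mul (hsin t))).congr_deriv (by ring))
    (fun t ht => hrs t ht _ N hNpos.le (by
      have h1 := hcs t
      rw [← hdef t]
      nlinarith [sq_nonneg ((P t + X / 2 * q t) * Real.sin (X * t / 2) -
        (Q t - X / 2 * p t) * Real.cos (X * t / 2)), sq_nonneg (R t), sq_nonneg (S t)]))
  obtain ⟨m, hm⟩ := exists_limit_of_abs_deriv_le_exp hμ (T := T) (C := D)
    (f := fun t => q t * Real.cos (X * t / 2) - p t * Real.sin (X * t / 2))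
    (f' := fun t => (Q t - X / 2 * p t) * Real.cos (X * t / 2) -
      (P t + X / 2 * q t) * Real.sin (X * t / 2))
    (fun t => (((h.hq t).mul (hcos t)).sub ((h.hp t).mul (hsin t))).congr_deriv (by ring))
    (fun t ht => hrs t ht _ N hNpos.le (by
      have h1 := hcs t
      rw [← hdef t]
      nlinarith [sq_nonneg ((P t + X / 2 * q t) * Real.cos (X * t / 2) +
        (Q t - X / 2 * p t) * Real.sin (X * t / 2)), sq_nonneg (R t), sq_nonneg (S t)]))
  have hexp : Filter.Tendsto (fun t => Real.exp (-μ * t)) Filter.atTop (nhds 0) :=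
    Real.tendsto_exp_atBot.comp
      (Filter.tendsto_id.const_mul_atTop_of_neg (neg_lt_zero.2 hμ))
  have hlim : ∀ {f : ℝ → ℝ} {x K : ℝ}, (∀ t ≥ T, |f t - x| ≤ K * Real.exp (-μ * t)) →
      Filter.Tendsto f Filter.atTop (nhds x) := by
    intro f x K hf
    rw [tendsto_iff_dist_tendsto_zero]
    refine squeeze_zero' (Filter.Eventually.of_forall fun _ => dist_nonneg)
      (Filter.eventually_atTop.2 ⟨T, hf⟩) ?_
    simpa using hexp.const_mul K
  have hwlim : Filter.Tendsto w Filter.atTop (nhds 0) := by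
    refine squeeze_zero' (Filter.Eventually.of_forall hwnn)
      (Filter.eventually_atTop.2 ⟨T, fun t ht => (hdec t ht).2⟩) ?_
    simpa using (hexp.pow 2).const_mul C
  have hlm : l ^ 2 + m ^ 2 = 1 := by
    have h1 := ((hlim hl).pow 2).add ((hlim hm).pow 2)
    have h2 : Filter.Tendsto (fun t => 1 + w t) Filter.atTop (nhds (1 + 0)) :=
      hwlim.const_add 1
    rw [add_zero] at h2
    refine tendsto_nhds_unique h1 (h2.congr fun t => ?_)
    have h3 := (hlev t).det_eq
    have h4 := hcs t
    linear_combination -h3 - (p t ^ 2 + q t ^ 2) * h4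
  obtain ⟨θ, hθl, hθm⟩ : ∃ θ : ℝ, Real.cos θ = l ∧ Real.sin θ = m := by
    have hn : ‖(⟨l, m⟩ : ℂ)‖ = 1 := by
      rw [Complex.norm_def, Complex.normSq_mk, Real.sqrt_eq_one]
      linarith
    refine ⟨Complex.arg ⟨l, m⟩, ?_, ?_⟩
    · rw [Complex.cos_arg (by rw [← norm_ne_zero_iff, hn]; exact one_ne_zero), hn, div_one]
    · rw [Complex.sin_arg, hn, div_one]
  subst hθl hθm
  set C₁ := 2 * (D / μ) with hC₁
  have hC₁pos : 0 < C₁ := by positivity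
  have habs : ∀ {x y c d e : ℝ}, |x| ≤ e → |y| ≤ e → |c| ≤ 1 → |d| ≤ 1 →
      |x * c + y * d| ≤ 2 * e := by
    intro x y c d e hx hy hc hd
    have h1 : |x * c| ≤ e := by
      rw [abs_mul]; nlinarith [abs_nonneg x, abs_nonneg c]
    have h2 : |y * d| ≤ e := by
      rw [abs_mul]; nlinarith [abs_nonneg y, abs_nonneg d]
    linarith [abs_add_le (x * c) (y * d)]
  have hpb : ∀ t ≥ T, |p t - Real.cos (X * t / 2 + θ)| ≤ C₁ * Real.exp (-μ * t) := by
    intro t ht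
    have := habs (hl t ht) (hm t ht) (Real.abs_cos_le_one (X * t / 2))
      ((abs_neg _).trans_le (Real.abs_sin_le_one (X * t / 2)))
    rw [hC₁, mul_assoc]
    refine le_of_eq_of_le (congrArg _ ?_) this
    rw [Real.cos_add]
    linear_combination (-p t) * hcs t
  have hqb : ∀ t ≥ T, |q t - Real.sin (X * t / 2 + θ)| ≤ C₁ * Real.exp (-μ * t) := by
    intro t ht
    have := habs (hl t ht) (hm t ht) (Real.abs_sin_le_one (X * t / 2))
      (Real.abs_cos_le_one (X * t / 2))
    rw [hC₁, mul_assoc]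
    refine le_of_eq_of_le (congrArg _ ?_) this
    rw [Real.sin_add]
    linear_combination (-q t) * hcs t
  have hrot : ∀ {x y e c k d : ℝ}, |x| ≤ d * e → |y| ≤ c * e → |x + k * y| ≤ (d + |k| * c) * e := by
    intro x y e c k d hx hy
    have h1 := abs_add_le x (k * y)
    rw [abs_mul] at h1
    nlinarith [mul_le_mul_of_nonneg_left hy (abs_nonneg k)]
  refine ⟨T, hT, Real.sqrt (1 * C) + C₁ + (D + |X / 2| * C₁), by positivity, θ, fun t ht => ?_⟩
  have ht' : t ≥ T := le_of_lt ht
  have hle : ∀ {x c : ℝ}, x ≤ c * Real.exp (-μ * t) →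
      c ≤ Real.sqrt (1 * C) + C₁ + (D + |X / 2| * C₁) →
      x ≤ (Real.sqrt (1 * C) + C₁ + (D + |X / 2| * C₁)) * Real.exp (-μ * t) :=
    fun hx hc => hx.trans (mul_le_mul_of_nonneg_right hc (Real.exp_pos _).le)
  have n1 : 0 ≤ Real.sqrt (1 * C) := Real.sqrt_nonneg _
  have n2 : 0 ≤ |X / 2| * C₁ := by positivity
  have hd := hdef t
  have sP := sq_nonneg (P t + X / 2 * q t)
  have sQ := sq_nonneg (Q t - X / 2 * p t)
  have sr := sq_nonneg (r t)
  have ss := sq_nonneg (s t)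
  have sR := sq_nonneg (R t)
  have sS := sq_nonneg (S t)
  refine ⟨⟨hle (hpb t ht') (by linarith), hle (hqb t ht') (by linarith),
    hle (hrs t ht' (r t) 1 zero_le_one (by simp only [hw_def]; linarith)) (by linarith),
    hle (hrs t ht' (s t) 1 zero_le_one (by simp only [hw_def]; linarith)) (by linarith)⟩,
    ⟨?_, ?_, hle (hrs t ht' (R t) N hNpos.le (by linarith)) (by linarith),
    hle (hrs t ht' (S t) N hNpos.le (by linarith)) (by linarith)⟩, ?_⟩
  · have h1 : |P t + X / 2 * q t| ≤ D * Real.exp (-μ * t) :=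
      hrs t ht' _ N hNpos.le (by linarith)
    have h2 := hrot (k := -(X / 2)) h1 (hqb t ht')
    rw [abs_neg] at h2
    refine hle (le_of_eq_of_le (congrArg _ ?_) h2) (by linarith)
    ring
  · have h1 : |Q t - X / 2 * p t| ≤ D * Real.exp (-μ * t) :=
      hrs t ht' _ N hNpos.le (by linarith)
    have h2 := hrot (k := X / 2) h1 (hpb t ht')
    refine hle (le_of_eq_of_le (congrArg _ ?_) h2) (by linarith)
    ring
  · have h1 := (hdec t ht').1
    have h2 := (hlev t).tangent
    linarith

theorem IsCoordFlow.reverse {κ : ℝ} {p q r s P Q R S L : ℝ → ℝ}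
    (h : IsCoordFlow κ p q r s P Q R S L) :
    IsCoordFlow κ (fun t => p (-t)) (fun t => q (-t)) (fun t => r (-t)) (fun t => s (-t))
      (fun t => -P (-t)) (fun t => -Q (-t)) (fun t => -R (-t)) (fun t => -S (-t))
      (fun t => L (-t)) := by
  have hcomp : ∀ {f : ℝ → ℝ} {f' t : ℝ}, HasDerivAt f f' (-t) →
      HasDerivAt (fun t => f (-t)) (-f') t := fun {f f' t} hf => by
    exact (hf.comp t (hasDerivAt_neg t)).congr_deriv (by ring)
  exact ⟨fun t => hcomp (h.hp (-t)), fun t => hcomp (h.hq (-t)), fun t => hcomp (h.hr (-t)),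
    fun t => hcomp (h.hs (-t)),
    fun t => (hcomp (h.hP (-t))).neg.congr_deriv (neg_neg _),
    fun t => (hcomp (h.hQ (-t))).neg.congr_deriv (neg_neg _),
    fun t => (hcomp (h.hR (-t))).neg.congr_deriv (neg_neg _),
    fun t => (hcomp (h.hS (-t))).neg.congr_deriv (neg_neg _),
    fun t ht => by simpa using h.hL (-t) ht⟩

theorem IsHomoclinicLevel.reverse {κ X p q r s P Q R S : ℝ}
    (h : IsHomoclinicLevel κ X p q r s P Q R S) :
    IsHomoclinicLevel κ (-X) p q r s (-P) (-Q) (-R) (-S) :=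
  ⟨h.det_eq, by linear_combination -h.tangent, by linear_combination -h.angular,
    by linear_combination -h.vorticity, by linear_combination h.energy⟩

theorem mip_eq (A B : M2) :
    mip A B = A 0 0 * B 0 0 + A 0 1 * B 0 1 + A 1 0 * B 1 0 + A 1 1 * B 1 1 := by
  simp [mip, Matrix.trace, Matrix.mul_apply, Fin.sum_univ_two]
  ring

theorem fnorm_le_of_coords {M : M2} {e : ℝ} (hp : |(M 0 0 + M 1 1) / 2| ≤ e)
    (hq : |(M 1 0 - M 0 1) / 2| ≤ e) (hr : |(M 0 0 - M 1 1) / 2| ≤ e)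
    (hs : |(M 1 0 + M 0 1) / 2| ≤ e) : fnorm M ≤ 3 * e := by
  have he : 0 ≤ e := (abs_nonneg _).trans hp
  refine Real.sqrt_le_iff.2 ⟨by positivity, ?_⟩
  rw [mip_eq]
  have h1 := sq_le_sq' (abs_le.1 hp).1 (abs_le.1 hp).2
  have h2 := sq_le_sq' (abs_le.1 hq).1 (abs_le.1 hq).2
  have h3 := sq_le_sq' (abs_le.1 hr).1 (abs_le.1 hr).2
  have h4 := sq_le_sq' (abs_le.1 hs).1 (abs_le.1 hs).2
  nlinarith

theorem Um_entries (θ : ℝ) : Um θ 0 0 = Real.cos θ ∧ Um θ 0 1 = -Real.sin θ ∧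
    Um θ 1 0 = Real.sin θ ∧ Um θ 1 1 = Real.cos θ := by
  simp [Um, Zm]

theorem Zm_mul_Um_entries (θ : ℝ) : (Zm * Um θ) 0 0 = -Real.sin θ ∧
    (Zm * Um θ) 0 1 = -Real.cos θ ∧ (Zm * Um θ) 1 0 = Real.cos θ ∧
    (Zm * Um θ) 1 1 = -Real.sin θ := by
  simp [Um, Zm, Matrix.mul_apply, Fin.sum_univ_two]

theorem fnorm_sub_Um_le {M : M2} {θ e : ℝ} (hp : |(M 0 0 + M 1 1) / 2 - Real.cos θ| ≤ e)
    (hq : |(M 1 0 - M 0 1) / 2 - Real.sin θ| ≤ e) (hr : |(M 0 0 - M 1 1) / 2| ≤ e)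
    (hs : |(M 1 0 + M 0 1) / 2| ≤ e) : fnorm (M - Um θ) ≤ 3 * e := by
  obtain ⟨h1, h2, h3, h4⟩ := Um_entries θ
  apply fnorm_le_of_coords <;> simp only [Matrix.sub_apply, h1, h2, h3, h4]
  · convert hp using 2; ring
  · convert hq using 2; ring
  · convert hr using 2; ring
  · convert hs using 2; ring

theorem fnorm_sub_smul_Zm_mul_Um_le {M : M2} {θ e c : ℝ}
    (hp : |(M 0 0 + M 1 1) / 2 + c * Real.sin θ| ≤ e)
    (hq : |(M 1 0 - M 0 1) / 2 - c * Real.cos θ| ≤ e) (hr : |(M 0 0 - M 1 1) / 2| ≤ e)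
    (hs : |(M 1 0 + M 0 1) / 2| ≤ e) : fnorm (M - c • (Zm * Um θ)) ≤ 3 * e := by
  obtain ⟨h1, h2, h3, h4⟩ := Zm_mul_Um_entries θ
  apply fnorm_le_of_coords <;>
    simp only [Matrix.sub_apply, Matrix.smul_apply, smul_eq_mul, h1, h2, h3, h4]
  · convert hp using 2; ring
  · convert hq using 2; ring
  · convert hr using 2; ring
  · convert hs using 2; ring

theorem isSO_of_coords {A : M2} (hdet : A.det = 1) (hr : A 0 0 - A 1 1 = 0)
    (hs : A 1 0 + A 0 1 = 0) : isSO A := by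
  refine ⟨hdet, Matrix.inv_eq_right_inv ?_⟩
  rw [Matrix.det_fin_two] at hdet
  have h1 : A 1 1 = A 0 0 := by linarith
  have h2 : A 0 1 = -A 1 0 := by linarith
  rw [h1, h2] at hdet
  ext i j
  fin_cases i <;> fin_cases j <;>
    simp [Matrix.mul_apply, Fin.sum_univ_two, h1, h2] <;> linarith

theorem isHomoclinicLevel_of_matrix {κ X : ℝ} {A B : M2} (hdet : A.det = 1)
    (htan : mip B (cofm A) = 0) (hX1 : X1 κ A B = κ + (1/4) * X ^ 2) (hX2 : X2 A B = 0)
    (hX3 : X3 A B = X) :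
    IsHomoclinicLevel κ X ((A 0 0 + A 1 1) / 2) ((A 1 0 - A 0 1) / 2) ((A 0 0 - A 1 1) / 2)
      ((A 1 0 + A 0 1) / 2) ((B 0 0 + B 1 1) / 2) ((B 1 0 - B 0 1) / 2) ((B 0 0 - B 1 1) / 2)
      ((B 1 0 + B 0 1) / 2) := by
  rw [Matrix.det_fin_two] at hdet
  simp only [X1, X2, X3, mip_eq, cofm, Zm, Matrix.sub_apply, Matrix.add_apply, Matrix.mul_apply,
    Fin.sum_univ_two, Matrix.of_apply, Matrix.cons_val', Matrix.cons_val_zero,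
    Matrix.cons_val_one, Matrix.cons_val_fin_one] at htan hX1 hX2 hX3
  constructor
  · linear_combination hdet
  · linear_combination htan / 2
  · linear_combination hX3 / 2
  · linear_combination hX2 / 2
  · linear_combination hX1

theorem isCoordFlow_of_matrix {κ : ℝ} {A : ℝ → M2} (hA : ContDiff ℝ 2 A)
    (hode : ∀ t : ℝ, deriv (deriv A) t + κ • A t
      = Lam κ (A t) (deriv A t) • cofm (A t)) :
    IsCoordFlow κ (fun t => (A t 0 0 + A t 1 1) / 2) (fun t => (A t 1 0 - A t 0 1) / 2)
      (fun t => (A t 0 0 - A t 1 1) / 2) (fun t => (A t 1 0 + A t 0 1) / 2)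
      (fun t => (deriv A t 0 0 + deriv A t 1 1) / 2) (fun t => (deriv A t 1 0 - deriv A t 0 1) / 2)
      (fun t => (deriv A t 0 0 - deriv A t 1 1) / 2) (fun t => (deriv A t 1 0 + deriv A t 0 1) / 2)
      (fun t => Lam κ (A t) (deriv A t)) := by
  have hA1 : ∀ t, HasDerivAt A (deriv A t) t := fun t =>
    (hA.differentiable (by norm_num) t).hasDerivAt
  have hA2 : ∀ t, HasDerivAt (deriv A) (deriv (deriv A) t) t := fun t =>
    (((contDiff_succ_iff_deriv (n := 1)).1 (by exact_mod_cast hA)).2.2.differentiable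
      (by norm_num) t).hasDerivAt
  have entry : ∀ {F : ℝ → M2} {F' : M2} {t : ℝ} (i j : Fin 2), HasDerivAt F F' t →
      HasDerivAt (fun t => F t i j) (F' i j) t := fun {F F' t} i j hF =>
    (LinearMap.toContinuousLinearMap (Matrix.entryLinearMap ℝ ℝ i j)).hasFDerivAt.comp_hasDerivAt
      t hF
  have h00 : ∀ t, deriv (deriv A) t 0 0 = Lam κ (A t) (deriv A t) * A t 1 1 - κ * A t 0 0 :=
    fun t => by
      have := congrFun (congrFun (hode t) 0) 0
      simp [cofm] at this
      linarith
  have h01 : ∀ t, deriv (deriv A) t 0 1 = -(Lam κ (A t) (deriv A t) * A t 1 0) - κ * A t 0 1 :=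
    fun t => by
      have := congrFun (congrFun (hode t) 0) 1
      simp [cofm] at this
      linarith
  have h10 : ∀ t, deriv (deriv A) t 1 0 = -(Lam κ (A t) (deriv A t) * A t 0 1) - κ * A t 1 0 :=
    fun t => by
      have := congrFun (congrFun (hode t) 1) 0
      simp [cofm] at this
      linarith
  have h11 : ∀ t, deriv (deriv A) t 1 1 = Lam κ (A t) (deriv A t) * A t 0 0 - κ * A t 1 1 :=
    fun t => by
      have := congrFun (congrFun (hode t) 1) 1
      simp [cofm] at this
      linarith
  constructor
  · exact fun t => ((entry 0 0 (hA1 t)).add (entry 1 1 (hA1 t))).div_const 2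
  · exact fun t => ((entry 1 0 (hA1 t)).sub (entry 0 1 (hA1 t))).div_const 2
  · exact fun t => ((entry 0 0 (hA1 t)).sub (entry 1 1 (hA1 t))).div_const 2
  · exact fun t => ((entry 1 0 (hA1 t)).add (entry 0 1 (hA1 t))).div_const 2
  · exact fun t => (((entry 0 0 (hA2 t)).add (entry 1 1 (hA2 t))).div_const 2).congr_deriv
      (by rw [h00, h11]; ring)
  · exact fun t => (((entry 1 0 (hA2 t)).sub (entry 0 1 (hA2 t))).div_const 2).congr_deriv
      (by rw [h10, h01]; ring)
  · exact fun t => (((entry 0 0 (hA2 t)).sub (entry 1 1 (hA2 t))).div_const 2).congr_deriv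
      (by rw [h00, h11]; ring)
  · exact fun t => (((entry 1 0 (hA2 t)).add (entry 0 1 (hA2 t))).div_const 2).congr_deriv
      (by rw [h10, h01]; ring)
  · intro t ht
    have hne : mip (A t) (A t) ≠ 0 := by
      rw [mip_eq]
      intro h
      apply ht
      linear_combination h / 2
    have hmul : Lam κ (A t) (deriv A t) * mip (A t) (A t) = 2 * (κ - (deriv A t).det) :=
      div_mul_cancel₀ _ hne
    rw [mip_eq, Matrix.det_fin_two] at hmul
    linear_combination hmul / 2

/-- homoclinic asymptotics towards rigid rotations for MHD (κ > 0). -/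
theorem homoclinic_asymptotics (κ : ℝ) (hκ : 0 < κ) (X₃ : ℝ) (hX₃ : 8 * κ < X₃ ^ 2)
    (A₀ B₀ : M2) (hdet : A₀.det = 1) (htan : mip B₀ (cofm A₀) = 0)
    (hX1 : X1 κ A₀ B₀ = κ + (1/4) * X₃ ^ 2) (hX2 : X2 A₀ B₀ = 0)
    (hX3 : X3 A₀ B₀ = X₃) (hnotSO : ¬ isSO A₀)
    (A : ℝ → M2) (hA : ContDiff ℝ 2 A)
    (hA0 : A 0 = A₀) (hB0 : deriv A 0 = B₀)
    (hode : ∀ t : ℝ, deriv (deriv A) t + κ • A t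
      = Lam κ (A t) (deriv A t) • cofm (A t)) :
    ∀ μ : ℝ, 0 < μ → μ < (1/2) * Real.sqrt (X₃ ^ 2 - 8 * κ) →
      ∃ T > (0:ℝ), ∃ C > (0:ℝ), ∃ θp θm : ℝ,
        (∀ t > T,
          fnorm (A t - Um (X₃ * t / 2 + θp)) ≤ C * Real.exp (-μ * t) ∧
          fnorm (deriv A t - (X₃ / 2) • (Zm * Um (X₃ * t / 2 + θp)))
            ≤ C * Real.exp (-μ * t) ∧
          mip (A t) (deriv A t) < 0) ∧
        (∀ t < -T,
          fnorm (A t - Um (X₃ * t / 2 + θm)) ≤ C * Real.exp (μ * t) ∧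
          fnorm (deriv A t - (X₃ / 2) • (Zm * Um (X₃ * t / 2 + θm)))
            ≤ C * Real.exp (μ * t) ∧
          0 < mip (A t) (deriv A t)) := by
  intro μ hμ hμX
  have hμN : μ ^ 2 < X₃ ^ 2 / 4 - 2 * κ := by
    have h1 : (Real.sqrt (X₃ ^ 2 - 8 * κ)) ^ 2 = X₃ ^ 2 - 8 * κ := Real.sq_sqrt (by linarith)
    nlinarith
  have hflow := isCoordFlow_of_matrix hA hode
  have hlevel : IsHomoclinicLevel κ X₃ _ _ _ _ _ _ _ _ :=
    isHomoclinicLevel_of_matrix hdet htan hX1 hX2 hX3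
  have hw : 0 < ((A₀ 0 0 - A₀ 1 1) / 2) ^ 2 + ((A₀ 1 0 + A₀ 0 1) / 2) ^ 2 := by
    by_contra! hle
    refine hnotSO (isSO_of_coords hdet ?_ ?_) <;> refine pow_eq_zero_iff two_ne_zero |>.1 ?_ <;>
      nlinarith [sq_nonneg (A₀ 0 0 - A₀ 1 1), sq_nonneg (A₀ 1 0 + A₀ 0 1)]
  subst hA0 hB0
  obtain ⟨Tp, hTp, Cp, hCp, θp, hp⟩ := hflow.forward_asymptotics hκ hμ hμN hlevel hw
  obtain ⟨Tm, hTm, Cm, hCm, θm, hm⟩ := hflow.reverse.forward_asymptotics (X := -X₃) hκ hμ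
    (by rwa [neg_sq]) (by simpa only [neg_zero] using hlevel.reverse)
    (by simpa only [neg_zero] using hw)
  refine ⟨max Tp Tm, lt_max_of_lt_left hTp, 3 * (Cp + Cm), by positivity, θp, θm,
    fun t ht => ?_, fun t ht => ?_⟩
  · obtain ⟨⟨h1, h2, h3, h4⟩, ⟨h5, h6, h7, h8⟩, h9⟩ := hp t ((le_max_left _ _).trans_lt ht)
    have hC : 3 * (Cp * Real.exp (-μ * t)) ≤ 3 * (Cp + Cm) * Real.exp (-μ * t) := by
      nlinarith [mul_pos hCm (Real.exp_pos (-μ * t))]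
    refine ⟨(fnorm_sub_Um_le h1 h2 h3 h4).trans hC,
      (fnorm_sub_smul_Zm_mul_Um_le h5 h6 h7 h8).trans hC, ?_⟩
    rw [mip_eq]
    linarith
  · obtain ⟨⟨h1, h2, h3, h4⟩, ⟨h5, h6, h7, h8⟩, h9⟩ :=
      hm (-t) ((le_max_right _ _).trans_lt (lt_neg_of_lt_neg ht))
    simp only [neg_neg, neg_mul, mul_neg, abs_neg] at h1 h2 h3 h4 h5 h6 h7 h8 h9
    rw [← abs_neg] at h5 h6
    have hC : 3 * (Cm * Real.exp (μ * t)) ≤ 3 * (Cp + Cm) * Real.exp (μ * t) := by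
      nlinarith [mul_pos hCp (Real.exp_pos (μ * t))]
    refine ⟨(fnorm_sub_Um_le h1 h2 h3 h4).trans hC,
      (fnorm_sub_smul_Zm_mul_Um_le ?_ ?_ h7 h8).trans hC, ?_⟩
    · convert h5 using 2; ring
    · convert h6 using 2; ring
    · rw [mip_eq]
      linarith
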